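/- Let R be a commutative ring and n ∈ ℕ. Then R is J-stable if and only if the formal power series ring R[[x₁, …, xₙ]] in n variables is J-stable. -/

import Mathlib

/-- A commutative ring has stable range 1 if whenever `aR + bR = R`,
there exists `y` such that `a + b * y` is a unit. -/
def StableRange1 (R : Type*) [CommRing R] : Prop :=
  ∀ a b : R, Ideal.span {a} ⊔ Ideal.span {b} = ⊤ → ∃ y : R, IsUnit (a + b * y)

/-- A commutative ring is J-stable if `R/aR` has stable range 1 for every
`a` not in the Jacobson radical. -/
def JStable (R : Type*) [CommRing R] : Prop :=
  ∀ a : R, a ∉ Ideal.jacobson (⊥ : Ideal R) → StableRange1 (R ⧸ Ideal.span {a})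

theorem isCoprime_mk_span_singleton_iff {R : Type*} [CommRing R] (a b c : R) :
    IsCoprime (Ideal.Quotient.mk (Ideal.span {a}) b) (Ideal.Quotient.mk (Ideal.span {a}) c) ↔
      ∃ r s t : R, IsUnit (a * r + b * s + c * t) := by
  constructor
  · rintro ⟨s, t, h⟩
    obtain ⟨s, rfl⟩ := Ideal.Quotient.mk_surjective s
    obtain ⟨t, rfl⟩ := Ideal.Quotient.mk_surjective t
    rw [← map_mul, ← map_mul, ← map_add, ← map_one (Ideal.Quotient.mk (Ideal.span {a})),
      Ideal.Quotient.mk_eq_mk_iff_sub_mem, Ideal.mem_span_singleton'] at h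
    obtain ⟨r, hr⟩ := h
    refine ⟨-r, s, t, ?_⟩
    rw [show a * -r + b * s + c * t = 1 by linear_combination -hr]
    exact isUnit_one
  · rintro ⟨r, s, t, h⟩
    obtain ⟨w, hw⟩ := h.exists_right_inv
    have ha : Ideal.Quotient.mk (Ideal.span {a}) a = 0 :=
      Ideal.Quotient.eq_zero_iff_mem.2 (Ideal.mem_span_singleton_self a)
    refine ⟨Ideal.Quotient.mk _ (s * w), Ideal.Quotient.mk _ (t * w), ?_⟩
    have := congrArg (Ideal.Quotient.mk (Ideal.span {a})) hw
    simp only [map_mul, map_add, ha, map_one] at this ⊢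
    linear_combination this

theorem isUnit_mk_span_singleton_iff {R : Type*} [CommRing R] (a b : R) :
    IsUnit (Ideal.Quotient.mk (Ideal.span {a}) b) ↔ ∃ r s : R, IsUnit (a * r + b * s) := by
  rw [← isCoprime_zero_right, ← map_zero (Ideal.Quotient.mk (Ideal.span {a})),
    isCoprime_mk_span_singleton_iff]
  simp

theorem jstable_iff_forall_isUnit (R : Type*) [CommRing R] :
    JStable R ↔ ∀ a : R, a ∉ Ideal.jacobson (⊥ : Ideal R) → ∀ b c r s t : R,
      IsUnit (a * r + b * s + c * t) → ∃ y u v : R, IsUnit (a * u + (b + c * y) * v) := by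
  refine forall₂_congr fun a _ => ?_
  simp only [StableRange1, ← Ideal.isCoprime_iff_sup_eq, Ideal.isCoprime_span_singleton_iff,
    Ideal.Quotient.mk_surjective.forall, Ideal.Quotient.mk_surjective.exists, ← map_mul,
    ← map_add, isCoprime_mk_span_singleton_iff, isUnit_mk_span_singleton_iff]
  simp only [forall_exists_index]

theorem map_mem_jacobson_bot_iff {R S : Type*} [CommRing R] [CommRing S] (φ : S →+* R)
    [IsLocalHom φ] (hφ : Function.Surjective φ) (s : S) :
    φ s ∈ Ideal.jacobson (⊥ : Ideal R) ↔ s ∈ Ideal.jacobson (⊥ : Ideal S) := by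
  simp only [Ideal.mem_jacobson_bot, hφ.forall, ← map_mul, ← map_one φ, ← map_add,
    isUnit_map_iff]

theorem jstable_iff_of_surjective_of_isLocalHom {R S : Type*} [CommRing R] [CommRing S]
    (φ : S →+* R) [IsLocalHom φ] (hφ : Function.Surjective φ) : JStable R ↔ JStable S := by
  simp only [jstable_iff_forall_isUnit, hφ.forall, hφ.exists, ← map_mul, ← map_add,
    isUnit_map_iff, map_mem_jacobson_bot_iff φ hφ]

theorem jstable_iff_mvPowerSeries (R : Type*) [CommRing R] (n : ℕ) :
    JStable R ↔ JStable (MvPowerSeries (Fin n) R) := by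
  have : IsLocalHom (MvPowerSeries.constantCoeff (σ := Fin n) (R := R)) :=
    ⟨fun _ h => MvPowerSeries.isUnit_iff_constantCoeff.2 h⟩
  exact jstable_iff_of_surjective_of_isLocalHom
    (MvPowerSeries.constantCoeff (σ := Fin n) (R := R))
    fun a => ⟨MvPowerSeries.C a, MvPowerSeries.constantCoeff_C a⟩
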